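/- For every n ≥ 1, the commutator subgroup [F_n, F_n] of F_n = FreeGroup (Fin n) (the kernel of the abelianization F_n → ℤ^n) belongs to L_n, and its Cantor–Bendixson rank in the space L_n is exactly n − 1, i.e., [F_n,F_n] ∈ D^{n-1}(L_n) \ D^{n}(L_n). (Equivalently, Rk(ℤ^n) = n, where Rk = CB + 1.) -/

import Mathlib

/-- The characteristic function of a subset, identifying `2^G` with `G → Bool`. -/
noncomputable def chi {G : Type*} (s : Set G) : G → Bool :=
  fun g => @decide (g ∈ s) (Classical.propDecidable _)

/-- `cbD A` is the set of points of `A` that are accumulation points of `A`,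
i.e. the non-isolated points of the subspace `A`.  Its iterates `cbD^[k] A`
are the finite Cantor–Bendixson derivatives `D^k(A)`. -/
def cbD {X : Type*} [TopologicalSpace X] (A : Set X) : Set X :=
  A ∩ derivedSet A

/-- A group `L` is fully residually free if for every finite subset `S ⊆ L` there
is a homomorphism `φ` to a free group of rank 2 with `φ s ≠ 1` for all `s ∈ S`, `s ≠ 1`. -/
def FullyResiduallyFree (L : Type*) [Group L] : Prop :=
  ∀ S : Finset L, ∃ φ : L →* FreeGroup (Fin 2), ∀ s ∈ S, s ≠ 1 → φ s ≠ 1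

/-- `LnSet n` is the set of (characteristic functions of) normal subgroups `N` of
`F_n` such that `F_n / N` is fully residually free, inside `2^{F_n}` with the
product topology. -/
def LnSet (n : ℕ) : Set (FreeGroup (Fin n) → Bool) :=
  {f | ∃ N : Subgroup (FreeGroup (Fin n)), ∃ hN : N.Normal,
    @FullyResiduallyFree (FreeGroup (Fin n) ⧸ N) (@QuotientGroup.Quotient.group _ _ N hN) ∧
      f = chi (N : Set (FreeGroup (Fin n)))}

open scoped commutatorElement

theorem aux_proj (s : ℕ) (T : Finset (Fin (s+2) → ℤ)) :
    ∃ ψ : (Fin (s+2) → ℤ) →+ (Fin (s+1) → ℤ), Function.Surjective ψ ∧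
      (∃ v, v ≠ 0 ∧ ψ v = 0) ∧ ∀ t ∈ T, t ≠ 0 → ψ t ≠ 0 := by
  obtain ⟨M, hM0, hM⟩ : ∃ M : ℤ, 0 < M ∧ ∀ t ∈ T, |t 1| < M := by
    refine ⟨∑ t ∈ T, |t 1| + 1, by positivity, fun t ht => ?_⟩
    have := Finset.single_le_sum (f := fun t : Fin (s+2) → ℤ => |t 1|)
      (fun i _ => abs_nonneg _) ht
    linarith
  let ψ : (Fin (s+2) → ℤ) →+ (Fin (s+1) → ℤ) :=
    { toFun := fun x i => x i.succ - (if i = 0 then M * x 0 else 0)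
      map_zero' := by ext i; simp
      map_add' := by
        intro x y; ext i
        by_cases h : i = 0
        · simp [h]; ring
        · simp [h] }
  have hψ : ∀ x i, ψ x i = x i.succ - (if i = 0 then M * x 0 else 0) := fun _ _ => rfl
  refine ⟨ψ, ?_, ⟨Fin.cons 1 (Fin.cons M 0), ?_, ?_⟩, ?_⟩
  · intro y
    refine ⟨Fin.cons 0 y, ?_⟩
    ext i
    simp [hψ]
  · intro h
    have := congrFun h 0
    simp at this
  · ext i
    rw [hψ]
    refine Fin.cases ?_ (fun j => ?_) i
    · simp
    · simp
  · intro t ht hne h0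
    apply hne
    have h1 : t 1 = M * t 0 := by
      have := congrFun h0 0
      rw [hψ] at this
      simp at this
      linarith
    have h00 : t 0 = 0 := by
      by_contra hc
      have h2 := hM t ht
      rw [h1, abs_mul, abs_of_pos hM0] at h2
      have : 1 ≤ |t 0| := Int.one_le_abs hc
      nlinarith
    ext i
    refine Fin.cases h00 (fun j => ?_) i
    have := congrFun h0 j
    rw [hψ] at this
    simpa [h00] using this

theorem aux_sep (r : ℕ) : ∀ T : Finset (Fin (r+1) → ℤ),
    ∃ ψ : (Fin (r+1) → ℤ) →+ ℤ, ∀ t ∈ T, t ≠ 0 → ψ t ≠ 0 := by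
  induction r with
  | zero =>
    intro T
    refine ⟨Pi.evalAddMonoidHom _ 0, fun t _ hne h => hne ?_⟩
    ext i
    have hi : i = 0 := Fin.ext (by have := i.2; simp)
    rw [hi]
    exact h
  | succ s ih =>
    intro T
    classical
    obtain ⟨ψ, _, _, h⟩ := aux_proj s T
    obtain ⟨χ, hχ⟩ := ih (T.image ψ)
    exact ⟨χ.comp ψ, fun t ht hne => hχ _ (Finset.mem_image_of_mem _ ht) (h t ht hne)⟩

theorem free_torsion {α : Type*} (x : FreeGroup α) (c : ℤ) (hc : c ≠ 0) (h : x ^ c = 1) :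
    x = 1 := by
  exact (IsMulTorsionFree.zpow_eq_one_iff_left hc).1 h

theorem ker_mem_Ln (n r : ℕ) (φ : FreeGroup (Fin n) →* Multiplicative (Fin (r+1) → ℤ)) :
    chi (φ.ker : Set (FreeGroup (Fin n))) ∈ LnSet n := by
  classical
  refine ⟨φ.ker, inferInstance, ?_, rfl⟩
  intro S
  let e := QuotientGroup.kerLift φ
  obtain ⟨ψ, hψ⟩ := aux_sep r (S.image fun s => (e s).toAdd)
  refine ⟨((zpowersHom (FreeGroup (Fin 2))) (FreeGroup.of 0)).comp
    ((AddMonoidHom.toMultiplicative ψ).comp e), fun s hs hne h => ?_⟩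
  have h1 : (e s).toAdd ≠ 0 := by
    intro h0
    apply hne
    apply QuotientGroup.kerLift_injective φ
    rw [map_one]
    exact h0
  have h2 := hψ _ (Finset.mem_image_of_mem _ hs) h1
  have h3 : (FreeGroup.of (0 : Fin 2)) ^ (ψ (e s).toAdd) = 1 := h
  have := free_torsion _ _ h2 h3
  exact FreeGroup.of_ne_one _ this

theorem mem_chi {G : Type*} (s : Set G) (g : G) : chi s g = true ↔ g ∈ s := by
  simp [chi]

theorem chi_congr {G : Type*} (s t : Set G) (g : G) : chi s g = chi t g ↔ (g ∈ s ↔ g ∈ t) := by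
  simp [chi]

theorem chi_inj {G : Type*} {s t : Set G} (h : chi s = chi t) : s = t := by
  ext g
  exact (chi_congr s t g).1 (congrFun h g)

theorem mem_cbD_iff {X : Type*} (A : Set (X → Bool)) (f : X → Bool) :
    f ∈ cbD A ↔ f ∈ A ∧ ∀ S : Finset X, ∃ g ∈ A, g ≠ f ∧ ∀ s ∈ S, g s = f s := by
  unfold cbD
  refine and_congr_right fun _ => ?_
  rw [mem_derivedSet, accPt_iff_nhds]
  constructor
  · intro h S
    have hU : {g : X → Bool | ∀ s ∈ S, g s = f s} ∈ nhds f := by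
      have : {g : X → Bool | ∀ s ∈ S, g s = f s} = (S : Set X).pi fun s => {f s} := by
        ext g; simp [Set.mem_pi]
      rw [this]
      exact set_pi_mem_nhds S.finite_toSet fun i _ => by simp
    obtain ⟨y, hy, hne⟩ := h _ hU
    exact ⟨y, hy.2, hne, hy.1⟩
  · intro h U hU
    rw [nhds_pi, Filter.mem_pi] at hU
    obtain ⟨I, hI, t, ht, hsub⟩ := hU
    obtain ⟨g, hg, hne, hag⟩ := h hI.toFinset
    refine ⟨g, ⟨hsub fun i hi => ?_, hg⟩, hne⟩
    rw [hag i (hI.mem_toFinset.2 hi)]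
    exact mem_of_mem_nhds (ht i)

theorem lower (n k : ℕ) : ∀ (r : ℕ) (φ : FreeGroup (Fin n) →* Multiplicative (Fin (r+1) → ℤ)),
    Function.Surjective φ → k ≤ r →
    chi (φ.ker : Set (FreeGroup (Fin n))) ∈ cbD^[k] (LnSet n) := by
  classical
  induction k with
  | zero => intro r φ _ _; exact ker_mem_Ln n r φ
  | succ k ih =>
    intro r φ hφ hk
    rw [Function.iterate_succ_apply', mem_cbD_iff]
    refine ⟨ih r φ hφ (by omega), fun S => ?_⟩
    obtain ⟨s, rfl⟩ : ∃ s, r = s + 1 := ⟨r - 1, by omega⟩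
    obtain ⟨ψ, hs, ⟨v, hv, hv0⟩, h⟩ := aux_proj s (S.image fun x => (φ x).toAdd)
    let φ' := (AddMonoidHom.toMultiplicative ψ).comp φ
    refine ⟨_, ih s φ' ?_ (by omega), ?_, ?_⟩
    · intro y
      obtain ⟨x, hx⟩ := hs y.toAdd
      obtain ⟨z, hz⟩ := hφ (Multiplicative.ofAdd x)
      refine ⟨z, ?_⟩
      change Multiplicative.ofAdd (ψ (φ z).toAdd) = y
      rw [hz]
      exact hx
    · intro he
      have he := chi_inj he
      obtain ⟨z, hz⟩ := hφ (Multiplicative.ofAdd v)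
      have : z ∈ (φ'.ker : Set (FreeGroup (Fin n))) := by
        change Multiplicative.ofAdd (ψ (φ z).toAdd) = 1
        rw [hz]
        exact hv0
      rw [he] at this
      apply hv
      have h' : φ z = 1 := this
      rw [hz] at h'
      exact h'
    · intro x hx
      rw [chi_congr]
      constructor
      · intro h1
        by_contra h2
        refine h _ (Finset.mem_image_of_mem _ hx) ?_ h1
        intro h3
        exact h2 h3
      · intro h1
        have h1 : φ x = 1 := h1
        change Multiplicative.ofAdd (ψ (φ x).toAdd) = 1
        rw [h1]
        exact map_zero ψ

/-- The abelianization map. -/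
def abHom (n : ℕ) : FreeGroup (Fin n) →* Multiplicative (Fin n → ℤ) :=
  FreeGroup.lift fun i => Multiplicative.ofAdd (Pi.single i 1)

/-- Its inverse modulo commutators. -/
def invHom (n : ℕ) : Multiplicative (Fin n → ℤ) →* Abelianization (FreeGroup (Fin n)) where
  toFun v := ∏ i, (Abelianization.of (FreeGroup.of i)) ^ (v.toAdd i)
  map_one' := by simp
  map_mul' x y := by simp [zpow_add, Finset.prod_mul_distrib]

theorem inv_ab (n : ℕ) (x : FreeGroup (Fin n)) : invHom n (abHom n x) = Abelianization.of x := by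
  have : (invHom n).comp (abHom n) = Abelianization.of := by
    ext i
    simp only [abHom, invHom, MonoidHom.comp_apply, FreeGroup.lift_apply_of, MonoidHom.coe_mk,
      OneHom.coe_mk, toAdd_ofAdd]
    rw [Finset.prod_eq_single i]
    · simp
    · intro b _ hb; simp [hb]
    · simp
  exact DFunLike.congr_fun this x

theorem abHom_surj (n : ℕ) : Function.Surjective (abHom n) := by
  intro v
  have : ∀ w : Fin n → ℤ, w ∈ (MonoidHom.toAdditiveLeft (abHom n)).range := by
    intro w
    rw [← Finset.univ_sum_single w]
    refine sum_mem fun i _ => ?_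
    have : (Pi.single i (w i) : Fin n → ℤ) = w i • Pi.single i 1 := by
      ext j; by_cases h : j = i
      · subst h; simp
      · simp [h]
    rw [this]
    refine AddSubgroup.zsmul_mem _ ?_ _
    refine ⟨Additive.ofMul (FreeGroup.of i), ?_⟩
    change (abHom n (FreeGroup.of i)).toAdd = _
    simp [abHom]
  obtain ⟨x, hx⟩ := this v.toAdd
  exact ⟨x.toMul, hx⟩

theorem abHom_ker (n : ℕ) : (abHom n).ker = commutator (FreeGroup (Fin n)) := by
  apply le_antisymm
  · intro x hx
    have h : abHom n x = 1 := hx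
    have := inv_ab n x
    rw [h, map_one] at this
    have h2 : x ∈ (Abelianization.of (G := FreeGroup (Fin n))).ker := this.symm
    rwa [Abelianization.ker_of] at h2
  · exact Abelianization.commutator_subset_ker _

/-- Image of a subgroup in `ℤ^n`. -/
def img (n : ℕ) (N : Subgroup (FreeGroup (Fin n))) : Submodule ℤ (Fin n → ℤ) :=
  AddSubgroup.toIntSubmodule (Subgroup.toAddSubgroup' (N.map (abHom n)))

theorem mem_img (n : ℕ) (N : Subgroup (FreeGroup (Fin n))) (hN : commutator _ ≤ N)
    (x : FreeGroup (Fin n)) : (abHom n x).toAdd ∈ img n N ↔ x ∈ N := by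
  constructor
  · rintro ⟨y, hy, hxy⟩
    have hxy : abHom n y = abHom n x := hxy
    have : y⁻¹ * x ∈ (abHom n).ker := by simp [MonoidHom.mem_ker, hxy]
    rw [abHom_ker] at this
    simpa using N.mul_mem hy (hN this)
  · intro h
    exact ⟨x, h, rfl⟩

theorem rank_lt (n : ℕ) (P Q : Submodule ℤ (Fin n → ℤ)) (hPQ : P < Q)
    (hP : ∀ (c : ℤ) v, c ≠ 0 → c • v ∈ P → v ∈ P) :
    Module.finrank ℤ P < Module.finrank ℤ Q := by
  obtain ⟨hle, v, hvQ, hvP⟩ := SetLike.lt_iff_le_and_exists.1 hPQ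
  let b := Module.finBasis ℤ P
  let w : Fin (Module.finrank ℤ P) → Q := fun i => Submodule.inclusion hle (b i)
  have hw : LinearIndependent ℤ w :=
    b.linearIndependent.map' (Submodule.inclusion hle)
      (LinearMap.ker_eq_bot.2 (Submodule.inclusion_injective hle))
  have := LinearIndependent.finCons' (⟨v, hvQ⟩ : Q) w hw (by
    intro c y hyS hy
    by_contra hc
    apply hvP
    apply hP c v hc
    have hyP : ((y : Q) : Fin n → ℤ) ∈ P := by
      have h1 : Submodule.span ℤ (Set.range w) ≤ P.comap Q.subtype := by
        rw [Submodule.span_le]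
        rintro _ ⟨i, rfl⟩
        exact (b i).2
      exact h1 hyS
    have h2 : c • v = -((y : Q) : Fin n → ℤ) := by
      have := congrArg (Subtype.val) hy
      exact eq_neg_of_add_eq_zero_left this
    rw [h2]
    exact P.neg_mem hyP)
  have := this.fintype_card_le_finrank
  simp at this
  omega

theorem pure_img (n : ℕ) (N : Subgroup (FreeGroup (Fin n))) (hN : commutator _ ≤ N)
    (h : chi (N : Set (FreeGroup (Fin n))) ∈ LnSet n) :
    ∀ (c : ℤ) v, c ≠ 0 → c • v ∈ img n N → v ∈ img n N := by
  intro c v hc hv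
  obtain ⟨N', hN', hF, he⟩ := h
  obtain rfl : N = N' := SetLike.coe_injective (chi_inj he)
  obtain ⟨x, hx⟩ := abHom_surj n (Multiplicative.ofAdd v)
  have hx' : v = (abHom n x).toAdd := by rw [hx]; rfl
  have hxc : c • v = (abHom n (x ^ c)).toAdd := by rw [map_zpow, hx]; rfl
  rw [hxc, mem_img n N hN] at hv
  rw [hx', mem_img n N hN]
  by_contra hxN
  obtain ⟨φ, hφ⟩ := hF {(x : FreeGroup (Fin n) ⧸ N)}
  have h1 := hφ _ (Finset.mem_singleton_self _) (by
    rwa [Ne, QuotientGroup.eq_one_iff])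
  apply h1
  apply free_torsion _ c hc
  rw [← map_zpow, ← QuotientGroup.mk_zpow, (QuotientGroup.eq_one_iff _).2 hv, map_one]

theorem comm_le (n : ℕ) (N : Subgroup (FreeGroup (Fin n))) [N.Normal]
    (h : ∀ i j : Fin n, ⁅FreeGroup.of i, FreeGroup.of j⁆ ∈ N) : commutator _ ≤ N := by
  have key : ∀ x y : FreeGroup (Fin n), Commute (x : FreeGroup (Fin n) ⧸ N) y := by
    have h1 : ∀ (i : Fin n) (y : FreeGroup (Fin n)),
        Commute ((FreeGroup.of i : FreeGroup (Fin n)) : FreeGroup (Fin n) ⧸ N) y := by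
      intro i y
      induction y using FreeGroup.induction_on with
      | C1 => exact Commute.one_right _
      | of j =>
        have := (QuotientGroup.eq_one_iff (N := N) _).2 (h i j)
        exact commutatorElement_eq_one_iff_commute.1 this
      | inv_of j hj => exact hj.inv_right
      | mul x y hx hy => exact hx.mul_right hy
    intro x y
    induction x using FreeGroup.induction_on with
    | C1 => exact Commute.one_left _
    | of j => exact h1 j y
    | inv_of j hj => exact hj.inv_left
    | mul a b ha hb => exact ha.mul_left hb
  rw [commutator_def, Subgroup.commutator_le]
  intro x _ y _
  rw [← QuotientGroup.eq_one_iff]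
  exact commutatorElement_eq_one_iff_commute.2 (key x y)

theorem cbD_sub (n k : ℕ) : cbD^[k] (LnSet n) ⊆ LnSet n := by
  induction k with
  | zero => exact subset_rfl
  | succ k ih =>
    rw [Function.iterate_succ_apply']
    exact fun x hx => ih hx.1

theorem upper (n k : ℕ) : ∀ N : Subgroup (FreeGroup (Fin n)), commutator _ ≤ N → N ≠ ⊤ →
    chi (N : Set (FreeGroup (Fin n))) ∈ cbD^[k] (LnSet n) →
    Module.finrank ℤ (img n N) + k + 1 ≤ n := by
  classical
  induction k with
  | zero =>
    intro N hN hne h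
    have : img n N < ⊤ := by
      rw [lt_top_iff_ne_top]
      intro ht
      apply hne
      rw [eq_top_iff]
      intro x _
      rw [← mem_img n N hN, ht]
      trivial
    have := rank_lt n _ _ this (pure_img n N hN h)
    simp at this
    omega
  | succ k ih =>
    intro N hN hne h
    have hL := cbD_sub n _ h
    rw [Function.iterate_succ_apply', mem_cbD_iff] at h
    obtain ⟨g, hg⟩ : ∃ g, g ∉ N := by
      by_contra hc
      push Not at hc
      exact hne (eq_top_iff.2 fun x _ => hc x)
    obtain ⟨T, hT⟩ := (IsNoetherian.noetherian (img n N) : (img n N).FG)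
    let sec : (Fin n → ℤ) → FreeGroup (Fin n) := fun v =>
      (abHom_surj n (Multiplicative.ofAdd v)).choose
    have hsec : ∀ v, (abHom n (sec v)).toAdd = v := fun v =>
      congrArg Multiplicative.toAdd (abHom_surj n (Multiplicative.ofAdd v)).choose_spec
    obtain ⟨f, hf, hfne, hag⟩ := h.2 (insert g (T.image sec ∪
      (Finset.univ : Finset (Fin n × Fin n)).image
        fun p => ⁅FreeGroup.of p.1, FreeGroup.of p.2⁆))
    obtain ⟨N', hN', hF, rfl⟩ := cbD_sub n k hf
    simp only [chi_congr, Finset.mem_insert, Finset.mem_union, Finset.mem_image] at hag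
    have hN'c : commutator _ ≤ N' := by
      apply comm_le
      intro i j
      refine (hag _ (Or.inr (Or.inr ⟨(i, j), Finset.mem_univ _, rfl⟩))).2 ?_
      exact hN (Subgroup.commutator_mem_commutator trivial trivial)
    have hle : img n N ≤ img n N' := by
      rw [← hT, Submodule.span_le]
      intro t ht
      have h1 : (abHom n (sec t)).toAdd ∈ img n N := by
        rw [hsec, ← hT]; exact Submodule.subset_span ht
      rw [mem_img n N hN] at h1
      have h2 := (hag _ (Or.inr (Or.inl ⟨t, ht, rfl⟩))).2 h1
      have h3 := (mem_img n N' hN'c _).2 h2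
      rwa [hsec] at h3
    have hlt : img n N < img n N' := by
      refine lt_of_le_of_ne hle fun he => hfne ?_
      congr 1
      ext x
      change x ∈ N' ↔ x ∈ N
      rw [← mem_img n N hN, ← mem_img n N' hN'c, he]
    have h1 := rank_lt n _ _ hlt (pure_img n N hN hL)
    have h2 := ih N' hN'c (by
      rintro rfl
      exact hg ((hag g (Or.inl rfl)).1 trivial)) hf
    omega

/-- The commutator subgroup `[F_n, F_n]` (the kernel of the abelianization
`F_n → ℤ^n`) belongs to `L_n` and has Cantor–Bendixson rank exactly `n - 1` in
`L_n`; equivalently `Rk(ℤ^n) = n`. -/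
theorem commutator_subgroup_CB_rank (n : ℕ) (hn : 1 ≤ n) :
    chi ((commutator (FreeGroup (Fin n)) : Subgroup (FreeGroup (Fin n))) :
        Set (FreeGroup (Fin n))) ∈ LnSet n ∧
      chi ((commutator (FreeGroup (Fin n)) : Subgroup (FreeGroup (Fin n))) :
          Set (FreeGroup (Fin n))) ∈
        cbD^[n - 1] (LnSet n) \ cbD^[n] (LnSet n) := by

  obtain ⟨m, rfl⟩ : ∃ m, n = m + 1 := ⟨n - 1, by omega⟩
  have h := abHom_ker (m + 1)
  refine ⟨?_, ?_, ?_⟩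
  · rw [← h]
    exact ker_mem_Ln _ m _
  · rw [← h]
    exact lower _ _ m _ (abHom_surj _) (by omega)
  · intro hc
    have := upper _ _ _ le_rfl (by
      intro ht
      rw [← h] at ht
      obtain ⟨x, hx⟩ := abHom_surj (m + 1) (Multiplicative.ofAdd (Pi.single 0 1))
      have h1 : x ∈ (abHom (m + 1)).ker := by rw [ht]; trivial
      have h2 : abHom (m + 1) x = 1 := h1
      rw [h2] at hx
      have h3 : (0 : Fin (m + 1) → ℤ) = Pi.single 0 1 := hx
      have := congrFun h3 0
      simp at this) hc
    omega
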